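/- (Substitution Principle SP as a theorem scheme) For all modal formulas φ, ψ, ψ' and every propositional variable x, the formula (ψ≡ψ')→(φ[x:=ψ]≡φ[x:=ψ']) is a theorem of S1+SP. -/

import Mathlib

/-- Modal formulas over countably many propositional variables x₀, x₁, …. -/
inductive Fm : Type
  | var : ℕ → Fm
  | neg : Fm → Fm
  | imp : Fm → Fm → Fm
  | box : Fm → Fm
deriving DecidableEq

namespace Fm

/-- ⊤ := x₀ → x₀ -/
def top : Fm := imp (var 0) (var 0)

/-- φ ∧ ψ := ¬(φ → ¬ψ) -/
def conj (φ ψ : Fm) : Fm := neg (imp φ (neg ψ))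

/-- φ ↔ ψ := (φ → ψ) ∧ (ψ → φ) -/
def biimp (φ ψ : Fm) : Fm := conj (imp φ ψ) (imp ψ φ)

/-- strict equivalence: φ ≡ ψ := □(φ → ψ) ∧ □(ψ → φ) -/
def equiv (φ ψ : Fm) : Fm := conj (box (imp φ ψ)) (box (imp ψ φ))

/-- φ[x := ψ]: substitution of ψ for all occurrences of the variable x in φ. -/
def subst (φ : Fm) (x : ℕ) (ψ : Fm) : Fm :=
  match φ with
  | var y => if y = x then ψ else var y
  | neg χ => neg (subst χ x ψ)
  | imp χ δ => imp (subst χ x ψ) (subst δ x ψ)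
  | box χ => box (subst χ x ψ)

/-- Propositional (two-valued) evaluation of a modal formula, treating
variables and boxed formulas as atoms. -/
def pEval (v : Fm → Bool) : Fm → Bool
  | var n => v (var n)
  | neg φ => !(pEval v φ)
  | imp φ ψ => !(pEval v φ) || pEval v ψ
  | box φ => v (box φ)

/-- φ has the form of a propositional tautology, i.e. φ is a substitution
instance of a propositional tautology. -/
def isTautInstance (φ : Fm) : Prop := ∀ v : Fm → Bool, pEval v φ = true

/-- The axioms (i)–(iii) of Lewis system S1 (Lemmon-style). -/
inductive S1Axiom : Fm → Prop
  | taut {φ} : isTautInstance φ → S1Axiom φ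
  | ax2 (φ) : S1Axiom (imp (box φ) φ)
  | ax3 (φ ψ χ) :
      S1Axiom (imp (conj (box (imp φ ψ)) (box (imp ψ χ))) (box (imp φ χ)))

/-- The identity axioms (iv)–(vi), i.e. the Substitution Principle SP. -/
inductive SPAxiom : Fm → Prop
  | ax4 (φ ψ) : SPAxiom (imp (equiv φ ψ) (equiv (neg φ) (neg ψ)))
  | ax5 (φ ψ φ' ψ') :
      SPAxiom (imp (conj (equiv φ ψ) (equiv φ' ψ'))
        (equiv (imp φ φ') (imp ψ ψ')))
  | ax6 (φ ψ) : SPAxiom (imp (equiv φ ψ) (equiv (box φ) (box ψ)))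

/-- Derivability in S1+SP from a set Φ of premises: axioms (i)–(vi),
modus ponens, and Axiom Necessitation AN restricted to axioms (i)–(iii). -/
inductive S1SP : Set Fm → Fm → Prop
  | prem {Φ φ} : φ ∈ Φ → S1SP Φ φ
  | axm {Φ φ} : S1Axiom φ → S1SP Φ φ
  | spAxm {Φ φ} : SPAxiom φ → S1SP Φ φ
  | mp {Φ φ ψ} : S1SP Φ (imp φ ψ) → S1SP Φ φ → S1SP Φ ψ
  | an {Φ φ} : S1Axiom φ → S1SP Φ (box φ)

end Fm

namespace Fm

theorem s1sp_taut {Φ : Set Fm} {φ : Fm} (h : isTautInstance φ) : S1SP Φ φ :=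
  .axm (.taut h)

theorem s1sp_trans {Φ : Set Fm} {a b c : Fm} (h1 : S1SP Φ (imp a b))
    (h2 : S1SP Φ (imp b c)) : S1SP Φ (imp a c) := by
  have t : S1SP Φ (imp (imp a b) (imp (imp b c) (imp a c))) := by
    apply s1sp_taut
    intro v
    simp only [pEval]
    cases pEval v a <;> cases pEval v b <;> cases pEval v c <;> rfl
  exact (t.mp h1).mp h2

theorem s1sp_conj {Φ : Set Fm} {a b c : Fm} (h1 : S1SP Φ (imp a b))
    (h2 : S1SP Φ (imp a c)) : S1SP Φ (imp a (conj b c)) := by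
  have t : S1SP Φ (imp (imp a b) (imp (imp a c) (imp a (conj b c)))) := by
    apply s1sp_taut
    intro v
    simp only [pEval, conj]
    cases pEval v a <;> cases pEval v b <;> cases pEval v c <;> rfl
  exact (t.mp h1).mp h2

theorem s1sp_self {Φ : Set Fm} (a : Fm) : S1SP Φ (imp a a) := by
  apply s1sp_taut
  intro v
  simp only [pEval]
  cases pEval v a <;> rfl

theorem s1sp_weaken {Φ : Set Fm} {b : Fm} (a : Fm) (h : S1SP Φ b) : S1SP Φ (imp a b) := by
  have t : S1SP Φ (imp b (imp a b)) := by
    apply s1sp_taut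
    intro v
    simp only [pEval]
    cases pEval v a <;> cases pEval v b <;> rfl
  exact t.mp h

theorem s1sp_equiv_refl {Φ : Set Fm} (a b : Fm) : S1SP Φ (imp a (equiv b b)) := by
  have h : S1SP Φ (box (imp b b)) := by
    apply S1SP.an
    apply S1Axiom.taut
    intro v
    simp only [pEval]
    cases pEval v b <;> rfl
  exact s1sp_conj (s1sp_weaken a h) (s1sp_weaken a h)

end Fm

open Fm in
/-- The Substitution Principle SP as a theorem scheme of S1+SP:
(ψ ≡ ψ') → (φ[x:=ψ] ≡ φ[x:=ψ']). -/
theorem substitution_principle (φ ψ ψ' : Fm) (x : ℕ) :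
    S1SP ∅ (imp (equiv ψ ψ') (equiv (subst φ x ψ) (subst φ x ψ'))) := by
  induction φ with
  | var y =>
    simp only [subst]
    split
    · exact s1sp_self _
    · exact s1sp_equiv_refl _ _
  | neg χ ih => exact s1sp_trans ih (.spAxm (.ax4 _ _))
  | imp χ δ ih1 ih2 => exact s1sp_trans (s1sp_conj ih1 ih2) (.spAxm (.ax5 _ _ _ _))
  | box χ ih => exact s1sp_trans ih (.spAxm (.ax6 _ _))
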